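/- Cross-term estimate for the time-consistency terms: let u ∈ W^{1,∞}([0,T];W^{3,∞}(Ω))² and let γ^x, γ^y be defined from u as below. Let K≥0 and let v=(v^x,v^y) be a discrete velocity with zero boundary values (v^x vanishing at i=0,N_x; v^y at j=0,N_y) satisfying |(d_x v^x + d_y v^y)_{i+1/2,j+1/2}| ≤ K(h²+k²+Δt) for all 0≤i≤N_x−1, 0≤j≤N_y−1. Then for every ε>0 there exists a constant C depending only on ε, K, Ω and ‖u‖_{W^{1,∞}([0,T];W^{3,∞}(Ω))} such that for every n: (D_x γ^{x,n}, v^x)_{l2,T,M} + (D_y γ^{y,n}, v^y)_{l2,M,T} ≤ ε‖v‖²_{l2} + C(h²+k²+Δt)². -/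

import Mathlib

open Finset MeasureTheory Real

noncomputable section

namespace RMAC

/-! ### Continuous-level notions -/

/-- Partial derivative in the first (x) variable of a function of (x, y, t). -/
def pdx (f : ℝ → ℝ → ℝ → ℝ) : ℝ → ℝ → ℝ → ℝ := fun x y t => deriv (fun s => f s y t) x

/-- Partial derivative in the second (y) variable. -/
def pdy (f : ℝ → ℝ → ℝ → ℝ) : ℝ → ℝ → ℝ → ℝ := fun x y t => deriv (fun s => f x s t) y

/-- Partial derivative in the third (t) variable. -/
def pdt (f : ℝ → ℝ → ℝ → ℝ) : ℝ → ℝ → ℝ → ℝ := fun x y t => deriv (fun s => f x y s) t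

/-- Infinitely differentiable function of (x, y, t). -/
def Smooth (f : ℝ → ℝ → ℝ → ℝ) : Prop :=
  ∀ n : ℕ, ContDiff ℝ n (fun q : ℝ × ℝ × ℝ => f q.1 q.2.1 q.2.2)

/-- `SobBound a b f Lx Ly T M` : all derivatives `∂_t^{a'} ∂_x^{b'} ∂_y^{c'} f` with `a' ≤ a`,
`b' + c' ≤ b` are bounded by `M` on `[0,Lx] × [0,Ly] × [0,T]`; this encodes
`‖f‖_{W^{a,∞}([0,T];W^{b,∞}(Ω))} ≤ M`. -/
def SobBound (a b : ℕ) (f : ℝ → ℝ → ℝ → ℝ) (Lx Ly T M : ℝ) : Prop :=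
  ∀ a' b' c' : ℕ, a' ≤ a → b' + c' ≤ b →
    ∀ x y t : ℝ, x ∈ Set.Icc 0 Lx → y ∈ Set.Icc 0 Ly → t ∈ Set.Icc 0 T →
      |(pdt^[a'] (pdx^[b'] (pdy^[c'] f))) x y t| ≤ M

/-- The time-dependent Stokes problem on `Ω = (0,Lx) × (0,Ly)`, `t ∈ (0,T]`, with
viscosity `μ`, source `(gx, gy)`, homogeneous Dirichlet boundary condition and
homogeneous initial condition. -/
def IsStokesSol (μ Lx Ly T : ℝ) (ux uy p gx gy : ℝ → ℝ → ℝ → ℝ) : Prop :=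
  (∀ x y t : ℝ, x ∈ Set.Ioo 0 Lx → y ∈ Set.Ioo 0 Ly → t ∈ Set.Ioc 0 T →
      pdt ux x y t - μ * (pdx (pdx ux) x y t + pdy (pdy ux) x y t) + pdx p x y t = gx x y t ∧
      pdt uy x y t - μ * (pdx (pdx uy) x y t + pdy (pdy uy) x y t) + pdy p x y t = gy x y t ∧
      pdx ux x y t + pdy uy x y t = 0) ∧
  (∀ x y t : ℝ, x ∈ Set.Icc 0 Lx → y ∈ Set.Icc 0 Ly → t ∈ Set.Ioc 0 T →
      (x = 0 ∨ x = Lx ∨ y = 0 ∨ y = Ly) → ux x y t = 0 ∧ uy x y t = 0) ∧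
  (∀ x y : ℝ, x ∈ Set.Icc 0 Lx → y ∈ Set.Icc 0 Ly → ux x y 0 = 0 ∧ uy x y 0 = 0)

/-- Divergence-free velocity field on `Ω` for all times in `[0,T]`. -/
def DivFree (Lx Ly T : ℝ) (ux uy : ℝ → ℝ → ℝ → ℝ) : Prop :=
  ∀ x y t : ℝ, x ∈ Set.Ioo 0 Lx → y ∈ Set.Ioo 0 Ly → t ∈ Set.Icc 0 T →
    pdx ux x y t + pdy uy x y t = 0

/-- Homogeneous velocity boundary values on `∂Ω` for all times in `[0,T]`. -/
def BoundaryZero (Lx Ly T : ℝ) (ux uy : ℝ → ℝ → ℝ → ℝ) : Prop :=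
  ∀ x y t : ℝ, x ∈ Set.Icc 0 Lx → y ∈ Set.Icc 0 Ly → t ∈ Set.Icc 0 T →
    (x = 0 ∨ x = Lx ∨ y = 0 ∨ y = Ly) → ux x y t = 0 ∧ uy x y t = 0

/-! ### The staggered (MAC) grid

Index conventions for grid functions `f : ℤ → ℤ → ℝ`:
* cell-centered functions: `f i j` is the value at `(x_{i+1/2}, y_{j+1/2})`;
* x-edge functions (like `u^x`): `f i j` is the value at `(x_i, y_{j+1/2})`,
  with `j = -1` and `j = Ny` the ghost values representing `(x_i, y_0)` and `(x_i, y_{Ny})`;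
* y-edge functions (like `u^y`): `f i j` is the value at `(x_{i+1/2}, y_j)`,
  with `i = -1` and `i = Nx` the ghost values representing `(x_0, y_j)` and `(x_{Nx}, y_j)`;
* node functions: `f i j` is the value at `(x_i, y_j)`. -/
structure Grid where
  Nx : ℕ
  Ny : ℕ
  Lx : ℝ
  Ly : ℝ
  xp : ℤ → ℝ
  yp : ℤ → ℝ
  one_le_Nx : 1 ≤ Nx
  one_le_Ny : 1 ≤ Ny
  xp_zero : xp 0 = 0
  xp_last : xp Nx = Lx
  yp_zero : yp 0 = 0
  yp_last : yp Ny = Ly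
  xp_mono : ∀ i : ℤ, 0 ≤ i → i < Nx → xp i < xp (i + 1)
  yp_mono : ∀ j : ℤ, 0 ≤ j → j < Ny → yp j < yp (j + 1)

namespace Grid

variable (G : Grid)

/-- `h_{i+1/2} = x_{i+1} - x_i`. -/
def hh (i : ℤ) : ℝ := G.xp (i + 1) - G.xp i

/-- `k_{j+1/2} = y_{j+1} - y_j`. -/
def kk (j : ℤ) : ℝ := G.yp (j + 1) - G.yp j

/-- `x_{i+1/2} = (x_i + x_{i+1})/2`. -/
def xh (i : ℤ) : ℝ := (G.xp i + G.xp (i + 1)) / 2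

/-- `y_{j+1/2} = (y_j + y_{j+1})/2`. -/
def yh (j : ℤ) : ℝ := (G.yp j + G.yp (j + 1)) / 2

/-- `h_i = (h_{i-1/2} + h_{i+1/2})/2`, with `h_0 = h_{1/2}/2`, `h_{Nx} = h_{Nx-1/2}/2`. -/
def hc (i : ℤ) : ℝ :=
  if i = 0 then G.hh 0 / 2
  else if i = (G.Nx : ℤ) then G.hh ((G.Nx : ℤ) - 1) / 2
  else (G.hh (i - 1) + G.hh i) / 2

/-- `k_j = (k_{j-1/2} + k_{j+1/2})/2`, with `k_0 = k_{1/2}/2`, `k_{Ny} = k_{Ny-1/2}/2`. -/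
def kc (j : ℤ) : ℝ :=
  if j = 0 then G.kk 0 / 2
  else if j = (G.Ny : ℤ) then G.kk ((G.Ny : ℤ) - 1) / 2
  else (G.kk (j - 1) + G.kk j) / 2

/-- `h = max_i h_{i+1/2}`. -/
def hmax : ℝ :=
  (Finset.Icc (0 : ℤ) ((G.Nx : ℤ) - 1)).sup'
    (Finset.nonempty_Icc.mpr (by have := G.one_le_Nx; omega)) G.hh

/-- `k = max_j k_{j+1/2}`. -/
def kmax : ℝ :=
  (Finset.Icc (0 : ℤ) ((G.Ny : ℤ) - 1)).sup'
    (Finset.nonempty_Icc.mpr (by have := G.one_le_Ny; omega)) G.kk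

/-- Mesh regularity: `min_{i,j} {h_{i+1/2}, k_{j+1/2}} ≥ C₀ · max_{i,j} {h_{i+1/2}, k_{j+1/2}}`. -/
def Regular (C₀ : ℝ) : Prop :=
  (∀ i : ℤ, 0 ≤ i → i < G.Nx → C₀ * G.hmax ≤ G.hh i ∧ C₀ * G.kmax ≤ G.hh i) ∧
  (∀ j : ℤ, 0 ≤ j → j < G.Ny → C₀ * G.hmax ≤ G.kk j ∧ C₀ * G.kmax ≤ G.kk j)

/-! ### Difference operators -/

/-- `d_x` of an x-edge function: value at the cell center `(x_{i+1/2}, y_{j+1/2})`. -/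
def dxEx (f : ℤ → ℤ → ℝ) (i j : ℤ) : ℝ := (f (i + 1) j - f i j) / G.hh i

/-- `D_y` of an x-edge function: value at the node `(x_i, y_j)`. -/
def DyEx (f : ℤ → ℤ → ℝ) (i j : ℤ) : ℝ := (f i j - f i (j - 1)) / G.kc j

/-- `d_y` of a y-edge function: value at the cell center `(x_{i+1/2}, y_{j+1/2})`. -/
def dyEy (f : ℤ → ℤ → ℝ) (i j : ℤ) : ℝ := (f i (j + 1) - f i j) / G.kk j

/-- `D_x` of a y-edge function: value at the node `(x_i, y_j)`. -/
def DxEy (f : ℤ → ℤ → ℝ) (i j : ℤ) : ℝ := (f i j - f (i - 1) j) / G.hc i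

/-- `D_x` of a cell-centered function: value at the x-edge point `(x_i, y_{j+1/2})`. -/
def DxC (q : ℤ → ℤ → ℝ) (i j : ℤ) : ℝ := (q i j - q (i - 1) j) / G.hc i

/-- `D_y` of a cell-centered function: value at the y-edge point `(x_{i+1/2}, y_j)`. -/
def DyC (q : ℤ → ℤ → ℝ) (i j : ℤ) : ℝ := (q i j - q i (j - 1)) / G.kc j

/-! ### Discrete inner products and norms -/

/-- `(f,g)_{l²,M}` over cell centers. -/
def ipM (f g : ℤ → ℤ → ℝ) : ℝ :=
  ∑ i ∈ Finset.Icc (0 : ℤ) ((G.Nx : ℤ) - 1), ∑ j ∈ Finset.Icc (0 : ℤ) ((G.Ny : ℤ) - 1),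
    G.hh i * G.kk j * f i j * g i j

/-- `(f,g)_{l²,T,M}` over x-edge points. -/
def ipTM (f g : ℤ → ℤ → ℝ) : ℝ :=
  ∑ i ∈ Finset.Icc (1 : ℤ) ((G.Nx : ℤ) - 1), ∑ j ∈ Finset.Icc (0 : ℤ) ((G.Ny : ℤ) - 1),
    G.hc i * G.kk j * f i j * g i j

/-- `(f,g)_{l²,M,T}` over y-edge points. -/
def ipMT (f g : ℤ → ℤ → ℝ) : ℝ :=
  ∑ i ∈ Finset.Icc (0 : ℤ) ((G.Nx : ℤ) - 1), ∑ j ∈ Finset.Icc (1 : ℤ) ((G.Ny : ℤ) - 1),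
    G.hh i * G.kc j * f i j * g i j

/-- `(f,g)_{l²,T_x}`. -/
def ipTx (f g : ℤ → ℤ → ℝ) : ℝ :=
  ∑ i ∈ Finset.Icc (0 : ℤ) (G.Nx : ℤ), ∑ j ∈ Finset.Icc (1 : ℤ) ((G.Ny : ℤ) - 1),
    G.hc i * G.kc j * f i j * g i j

/-- `(f,g)_{l²,T_y}`. -/
def ipTy (f g : ℤ → ℤ → ℝ) : ℝ :=
  ∑ i ∈ Finset.Icc (1 : ℤ) ((G.Nx : ℤ) - 1), ∑ j ∈ Finset.Icc (0 : ℤ) (G.Ny : ℤ),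
    G.hc i * G.kc j * f i j * g i j

/-- `‖v‖²_{l²} = ‖v^x‖²_{l²,T,M} + ‖v^y‖²_{l²,M,T}` for a discrete velocity. -/
def velNormSq (vx vy : ℤ → ℤ → ℝ) : ℝ := G.ipTM vx vx + G.ipMT vy vy

/-- `‖Dv‖²_{l²}` for a discrete velocity. -/
def DvelNormSq (vx vy : ℤ → ℤ → ℝ) : ℝ :=
  G.ipM (G.dxEx vx) (G.dxEx vx) + G.ipTy (G.DyEx vx) (G.DyEx vx) +
    G.ipTx (G.DxEy vy) (G.DxEy vy) + G.ipM (G.dyEy vy) (G.dyEy vy)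

/-! ### Right-hand side discretization and the RMAC scheme -/

/-- `f^{x,n}_{i,j+1/2} = (1/h_i) ∫_{x_{i-1/2}}^{x_{i+1/2}} g^x(x, y_{j+1/2}, t^n) dx`. -/
def avgFx (gx : ℝ → ℝ → ℝ → ℝ) (Δt : ℝ) : ℕ → ℤ → ℤ → ℝ := fun n i j =>
  (1 / G.hc i) * ∫ x in (G.xh (i - 1))..(G.xh i), gx x (G.yh j) ((n : ℝ) * Δt)

/-- `f^{y,n}_{i+1/2,j} = (1/k_j) ∫_{y_{j-1/2}}^{y_{j+1/2}} g^y(x_{i+1/2}, y, t^n) dy`. -/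
def avgFy (gy : ℝ → ℝ → ℝ → ℝ) (Δt : ℝ) : ℕ → ℤ → ℤ → ℝ := fun n i j =>
  (1 / G.kc j) * ∫ y in (G.yh (j - 1))..(G.yh j), gy (G.xh i) y ((n : ℝ) * Δt)

/-- The RMAC scheme for the time-dependent Stokes equations, with discrete right-hand
sides `fx`, `fy`: homogeneous discrete boundary and initial conditions, the two discrete
momentum equations and the discrete divergence-free constraint. -/
def IsRMAC (μ Δt : ℝ) (fx fy Wx Wy Z : ℕ → ℤ → ℤ → ℝ) : Prop :=
  (∀ n : ℕ, ∀ j : ℤ, Wx n 0 j = 0 ∧ Wx n (G.Nx : ℤ) j = 0) ∧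
  (∀ n : ℕ, ∀ i : ℤ, Wx n i (-1) = 0 ∧ Wx n i (G.Ny : ℤ) = 0) ∧
  (∀ n : ℕ, ∀ i : ℤ, Wy n i 0 = 0 ∧ Wy n i (G.Ny : ℤ) = 0) ∧
  (∀ n : ℕ, ∀ j : ℤ, Wy n (-1) j = 0 ∧ Wy n (G.Nx : ℤ) j = 0) ∧
  (∀ i j : ℤ, Wx 0 i j = 0 ∧ Wy 0 i j = 0) ∧
  (∀ n : ℕ, 1 ≤ n →
    ∀ i ∈ Finset.Icc (1 : ℤ) ((G.Nx : ℤ) - 1), ∀ j ∈ Finset.Icc (0 : ℤ) ((G.Ny : ℤ) - 1),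
      (Wx n i j - Wx (n - 1) i j) / Δt
        - μ * ((G.dxEx (Wx n) i j - G.dxEx (Wx n) (i - 1) j) / G.hc i)
        - μ * ((G.DyEx (Wx n) i (j + 1) - G.DyEx (Wx n) i j) / G.kk j)
        + G.DxC (Z n) i j = fx n i j) ∧
  (∀ n : ℕ, 1 ≤ n →
    ∀ i ∈ Finset.Icc (0 : ℤ) ((G.Nx : ℤ) - 1), ∀ j ∈ Finset.Icc (1 : ℤ) ((G.Ny : ℤ) - 1),
      (Wy n i j - Wy (n - 1) i j) / Δt
        - μ * ((G.DxEy (Wy n) (i + 1) j - G.DxEy (Wy n) i j) / G.hh i)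
        - μ * ((G.dyEy (Wy n) i j - G.dyEy (Wy n) i (j - 1)) / G.kc j)
        + G.DyC (Z n) i j = fy n i j) ∧
  (∀ n : ℕ, 1 ≤ n →
    ∀ i ∈ Finset.Icc (0 : ℤ) ((G.Nx : ℤ) - 1), ∀ j ∈ Finset.Icc (0 : ℤ) ((G.Ny : ℤ) - 1),
      G.dxEx (Wx n) i j + G.dyEy (Wy n) i j = 0)

/-- The compact-support condition: the discrete solution vanishes within one mesh
layer of `∂Ω`. -/
def CompactSupp (Wx Wy Z : ℕ → ℤ → ℤ → ℝ) : Prop :=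
  (∀ n : ℕ, ∀ j : ℤ,
    Wx n 0 j = 0 ∧ Wx n 1 j = 0 ∧ Wx n ((G.Nx : ℤ) - 1) j = 0 ∧ Wx n (G.Nx : ℤ) j = 0) ∧
  (∀ n : ℕ, ∀ i : ℤ,
    Wx n i (-1) = 0 ∧ Wx n i 0 = 0 ∧ Wx n i ((G.Ny : ℤ) - 1) = 0 ∧ Wx n i (G.Ny : ℤ) = 0) ∧
  (∀ n : ℕ, ∀ j : ℤ,
    Wy n (-1) j = 0 ∧ Wy n 0 j = 0 ∧ Wy n ((G.Nx : ℤ) - 1) j = 0 ∧ Wy n (G.Nx : ℤ) j = 0) ∧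
  (∀ n : ℕ, ∀ i : ℤ,
    Wy n i 0 = 0 ∧ Wy n i 1 = 0 ∧ Wy n i ((G.Ny : ℤ) - 1) = 0 ∧ Wy n i (G.Ny : ℤ) = 0) ∧
  (∀ n : ℕ, ∀ j : ℤ, Z n 0 j = 0) ∧
  (∀ n : ℕ, ∀ i : ℤ, Z n i 0 = 0)

/-! ### Auxiliary interpolants and consistency functions -/

/-- The auxiliary interpolant `ũ^{x,n}_{i,j+1/2}`, with its boundary extension. -/
def tux (ux : ℝ → ℝ → ℝ → ℝ) (Δt : ℝ) (n : ℕ) (i j : ℤ) : ℝ :=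
  if j = -1 then ux (G.xp i) (G.yp 0) ((n : ℝ) * Δt)
  else if j = (G.Ny : ℤ) then ux (G.xp i) (G.yp (G.Ny : ℤ)) ((n : ℝ) * Δt)
  else (1 / G.kk j) * (∫ y in (G.yp j)..(G.yp (j + 1)), ux (G.xp i) y ((n : ℝ) * Δt))
    - (G.kk j) ^ 2 / 6 * pdy (pdy ux) (G.xp i) (G.yh j) ((n : ℝ) * Δt)

/-- The auxiliary interpolant `ũ^{y,n}_{i+1/2,j}`, with its boundary extension. -/
def tuy (uy : ℝ → ℝ → ℝ → ℝ) (Δt : ℝ) (n : ℕ) (i j : ℤ) : ℝ :=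
  if i = -1 then uy (G.xp 0) (G.yp j) ((n : ℝ) * Δt)
  else if i = (G.Nx : ℤ) then uy (G.xp (G.Nx : ℤ)) (G.yp j) ((n : ℝ) * Δt)
  else (1 / G.hh i) * (∫ x in (G.xp i)..(G.xp (i + 1)), uy x (G.yp j) ((n : ℝ) * Δt))
    - (G.hh i) ^ 2 / 6 * pdx (pdx uy) (G.xh i) (G.yp j) ((n : ℝ) * Δt)

/-- `γ^{x,n}_{i+1/2,j+1/2} = (h_{i+1/2}²/8) ∂²u^x/∂t∂x (x_{i+1/2}, y_{j+1/2}, t^n)`. -/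
def gammax (ux : ℝ → ℝ → ℝ → ℝ) (Δt : ℝ) (n : ℕ) (i j : ℤ) : ℝ :=
  (G.hh i) ^ 2 / 8 * pdt (pdx ux) (G.xh i) (G.yh j) ((n : ℝ) * Δt)

/-- `γ^{y,n}_{i+1/2,j+1/2} = (k_{j+1/2}²/8) ∂²u^y/∂t∂y (x_{i+1/2}, y_{j+1/2}, t^n)`. -/
def gammay (uy : ℝ → ℝ → ℝ → ℝ) (Δt : ℝ) (n : ℕ) (i j : ℤ) : ℝ :=
  (G.kk j) ^ 2 / 8 * pdt (pdy uy) (G.xh i) (G.yh j) ((n : ℝ) * Δt)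

end Grid

/-! ### Averaging (interpolation) operators on a uniform grid -/

/-- `P^x_h` : x-edge function → cell-centered function. -/
def PxEx (f : ℤ → ℤ → ℝ) (i j : ℤ) : ℝ := (f i j + f (i + 1) j) / 2

/-- `P^x_h` : cell-centered function → x-edge function. -/
def PxC (q : ℤ → ℤ → ℝ) (i j : ℤ) : ℝ := (q (i - 1) j + q i j) / 2

/-- `P^x_h` : y-edge function → node function. -/
def PxEyN (f : ℤ → ℤ → ℝ) (i j : ℤ) : ℝ := (f (i - 1) j + f i j) / 2

/-- `P^x_h` : node function → y-edge function. -/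
def PxN (g : ℤ → ℤ → ℝ) (i j : ℤ) : ℝ := (g i j + g (i + 1) j) / 2

/-- `P^y_h` : y-edge function → cell-centered function. -/
def PyEy (f : ℤ → ℤ → ℝ) (i j : ℤ) : ℝ := (f i j + f i (j + 1)) / 2

/-- `P^y_h` : cell-centered function → y-edge function. -/
def PyC (q : ℤ → ℤ → ℝ) (i j : ℤ) : ℝ := (q i (j - 1) + q i j) / 2

/-- `P^y_h` : x-edge function → node function. -/
def PyEx (f : ℤ → ℤ → ℝ) (i j : ℤ) : ℝ := (f i (j - 1) + f i j) / 2

/-- `P^y_h` : node function → x-edge function. -/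
def PyN (g : ℤ → ℤ → ℝ) (i j : ℤ) : ℝ := (g i j + g i (j + 1)) / 2

namespace Grid

variable (G : Grid)

/-- The discrete nonlinear term `α^{x,n}_{i,j+1/2}` of the fully implicit RMAC scheme. -/
def alphaX (Wx Wy : ℤ → ℤ → ℝ) (i j : ℤ) : ℝ :=
  (Wx i j * G.DxC (PxEx Wx) i j
    + PxC (G.dxEx fun a b => (Wx a b) ^ 2) i j
    + PyN (fun a b => PxEyN Wy a b * G.DyEx Wx a b) i j
    + (PyEx Wx i (j + 1) * PxEyN Wy i (j + 1) - PyEx Wx i j * PxEyN Wy i j) / G.kk j) / 2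

/-- The discrete nonlinear term `α^{y,n}_{i+1/2,j}` of the fully implicit RMAC scheme. -/
def alphaY (Wx Wy : ℤ → ℤ → ℝ) (i j : ℤ) : ℝ :=
  (Wy i j * G.DyC (PyEy Wy) i j
    + PyC (G.dyEy fun a b => (Wy a b) ^ 2) i j
    + PxN (fun a b => PyEx Wx a b * G.DxEy Wy a b) i j
    + (PyEx Wx (i + 1) j * PxEyN Wy (i + 1) j - PyEx Wx i j * PxEyN Wy i j) / G.hh i) / 2

/-- The fully implicit RMAC scheme for the Navier–Stokes equations. -/
def IsRMACNS (μ Δt : ℝ) (fx fy Wx Wy Z : ℕ → ℤ → ℤ → ℝ) : Prop :=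
  (∀ n : ℕ, ∀ j : ℤ, Wx n 0 j = 0 ∧ Wx n (G.Nx : ℤ) j = 0) ∧
  (∀ n : ℕ, ∀ i : ℤ, Wx n i (-1) = 0 ∧ Wx n i (G.Ny : ℤ) = 0) ∧
  (∀ n : ℕ, ∀ i : ℤ, Wy n i 0 = 0 ∧ Wy n i (G.Ny : ℤ) = 0) ∧
  (∀ n : ℕ, ∀ j : ℤ, Wy n (-1) j = 0 ∧ Wy n (G.Nx : ℤ) j = 0) ∧
  (∀ i j : ℤ, Wx 0 i j = 0 ∧ Wy 0 i j = 0) ∧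
  (∀ n : ℕ, 1 ≤ n →
    ∀ i ∈ Finset.Icc (1 : ℤ) ((G.Nx : ℤ) - 1), ∀ j ∈ Finset.Icc (0 : ℤ) ((G.Ny : ℤ) - 1),
      (Wx n i j - Wx (n - 1) i j) / Δt
        - μ * ((G.dxEx (Wx n) i j - G.dxEx (Wx n) (i - 1) j) / G.hc i)
        - μ * ((G.DyEx (Wx n) i (j + 1) - G.DyEx (Wx n) i j) / G.kk j)
        + G.alphaX (Wx n) (Wy n) i j
        + G.DxC (Z n) i j = fx n i j) ∧
  (∀ n : ℕ, 1 ≤ n →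
    ∀ i ∈ Finset.Icc (0 : ℤ) ((G.Nx : ℤ) - 1), ∀ j ∈ Finset.Icc (1 : ℤ) ((G.Ny : ℤ) - 1),
      (Wy n i j - Wy (n - 1) i j) / Δt
        - μ * ((G.DxEy (Wy n) (i + 1) j - G.DxEy (Wy n) i j) / G.hh i)
        - μ * ((G.dyEy (Wy n) i j - G.dyEy (Wy n) i (j - 1)) / G.kc j)
        + G.alphaY (Wx n) (Wy n) i j
        + G.DyC (Z n) i j = fy n i j) ∧
  (∀ n : ℕ, 1 ≤ n →
    ∀ i ∈ Finset.Icc (0 : ℤ) ((G.Nx : ℤ) - 1), ∀ j ∈ Finset.Icc (0 : ℤ) ((G.Ny : ℤ) - 1),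
      G.dxEx (Wx n) i j + G.dyEy (Wy n) i j = 0)

/-- A uniform grid with mesh sizes `h` (in x) and `k` (in y). -/
def Uniform (h k : ℝ) : Prop :=
  (∀ i : ℤ, 0 ≤ i → i < G.Nx → G.hh i = h) ∧ (∀ j : ℤ, 0 ≤ j → j < G.Ny → G.kk j = k)

end Grid

end RMAC

open RMAC

namespace RMAC

/-! ### Commuting partial derivatives of smooth functions -/

/-- The directional derivative in a fixed direction of a smooth function is smooth. -/
lemma contDiff_fderiv_apply_const {F : ℝ × ℝ × ℝ → ℝ} (hF : ∀ n : ℕ, ContDiff ℝ n F)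
    (v : ℝ × ℝ × ℝ) (n : ℕ) : ContDiff ℝ n (fun q => fderiv ℝ F q v) :=
  ((hF (n + 1)).fderiv_right (m := n) (by norm_cast)).clm_apply contDiff_const

lemma fderiv_fderiv_apply_comm {F : ℝ × ℝ × ℝ → ℝ} (hF : ∀ n : ℕ, ContDiff ℝ n F)
    (v w q : ℝ × ℝ × ℝ) :
    fderiv ℝ (fun q => fderiv ℝ F q v) q w = fderiv ℝ (fun q => fderiv ℝ F q w) q v := by
  have hd : DifferentiableAt ℝ (fderiv ℝ F) q :=
    (((hF 2).fderiv_right (m := 1) (by norm_cast)).differentiable (by norm_num)) q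
  have happ : ∀ a b : ℝ × ℝ × ℝ,
      fderiv ℝ (fun q => fderiv ℝ F q a) q b = fderiv ℝ (fderiv ℝ F) q b a := fun a b => by
    rw [fderiv_clm_apply hd (differentiableAt_const a)]
    simp
  rw [happ, happ]
  exact ((hF 2).contDiffAt.isSymmSndFDerivAt (by simp)) w v

namespace Smooth

variable {f : ℝ → ℝ → ℝ → ℝ}

lemma pdx_eq (hf : Smooth f) : pdx f =
    fun x y t => fderiv ℝ (fun q : ℝ × ℝ × ℝ => f q.1 q.2.1 q.2.2) (x, y, t) (1, 0, 0) := by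
  funext x y t
  have hc : HasDerivAt (fun s : ℝ => (s, y, t)) ((1 : ℝ), (0 : ℝ), (0 : ℝ)) x :=
    (hasDerivAt_id x).prodMk (hasDerivAt_const x (y, t))
  exact ((((hf 1).differentiable (by norm_num)) (x, y, t)).hasFDerivAt.comp_hasDerivAt x hc).deriv

lemma pdy_eq (hf : Smooth f) : pdy f =
    fun x y t => fderiv ℝ (fun q : ℝ × ℝ × ℝ => f q.1 q.2.1 q.2.2) (x, y, t) (0, 1, 0) := by
  funext x y t
  have hc : HasDerivAt (fun s : ℝ => (x, s, t)) ((0 : ℝ), (1 : ℝ), (0 : ℝ)) y :=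
    (hasDerivAt_const y x).prodMk ((hasDerivAt_id y).prodMk (hasDerivAt_const y t))
  exact ((((hf 1).differentiable (by norm_num)) (x, y, t)).hasFDerivAt.comp_hasDerivAt y hc).deriv

lemma pdt_eq (hf : Smooth f) : pdt f =
    fun x y t => fderiv ℝ (fun q : ℝ × ℝ × ℝ => f q.1 q.2.1 q.2.2) (x, y, t) (0, 0, 1) := by
  funext x y t
  have hc : HasDerivAt (fun s : ℝ => (x, y, s)) ((0 : ℝ), (0 : ℝ), (1 : ℝ)) t :=
    (hasDerivAt_const t x).prodMk ((hasDerivAt_const t y).prodMk (hasDerivAt_id t))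
  exact ((((hf 1).differentiable (by norm_num)) (x, y, t)).hasFDerivAt.comp_hasDerivAt t hc).deriv

protected lemma pdx (hf : Smooth f) : Smooth (pdx f) := by
  rw [hf.pdx_eq]
  exact contDiff_fderiv_apply_const hf _

protected lemma pdy (hf : Smooth f) : Smooth (pdy f) := by
  rw [hf.pdy_eq]
  exact contDiff_fderiv_apply_const hf _

protected lemma pdt (hf : Smooth f) : Smooth (pdt f) := by
  rw [hf.pdt_eq]
  exact contDiff_fderiv_apply_const hf _

lemma pdx_pdy (hf : Smooth f) : RMAC.pdx (RMAC.pdy f) = RMAC.pdy (RMAC.pdx f) := by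
  rw [hf.pdy.pdx_eq, hf.pdx.pdy_eq, hf.pdy_eq, hf.pdx_eq]
  funext x y t
  exact fderiv_fderiv_apply_comm hf _ _ _

lemma pdx_pdt (hf : Smooth f) : RMAC.pdx (RMAC.pdt f) = RMAC.pdt (RMAC.pdx f) := by
  rw [hf.pdt.pdx_eq, hf.pdx.pdt_eq, hf.pdt_eq, hf.pdx_eq]
  funext x y t
  exact fderiv_fderiv_apply_comm hf _ _ _

lemma pdy_pdt (hf : Smooth f) : RMAC.pdy (RMAC.pdt f) = RMAC.pdt (RMAC.pdy f) := by
  rw [hf.pdt.pdy_eq, hf.pdy.pdt_eq, hf.pdt_eq, hf.pdy_eq]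
  funext x y t
  exact fderiv_fderiv_apply_comm hf _ _ _

lemma differentiable_fst (hf : Smooth f) (y t : ℝ) : Differentiable ℝ (fun x => f x y t) :=
  ((hf 1).differentiable (by norm_num)).comp
    (differentiable_id.prodMk (differentiable_const (y, t)))

lemma differentiable_snd (hf : Smooth f) (x t : ℝ) : Differentiable ℝ (fun y => f x y t) :=
  ((hf 1).differentiable (by norm_num)).comp
    ((differentiable_const x).prodMk (differentiable_id.prodMk (differentiable_const t)))

lemma abs_sub_le_of_pdx (hf : Smooth f) {x₁ x₂ y t L M : ℝ}
    (hM : ∀ x ∈ Set.Icc 0 L, |RMAC.pdx f x y t| ≤ M)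
    (h₁ : x₁ ∈ Set.Icc 0 L) (h₂ : x₂ ∈ Set.Icc 0 L) :
    |f x₂ y t - f x₁ y t| ≤ M * |x₂ - x₁| :=
  (convex_Icc (0 : ℝ) L).norm_image_sub_le_of_norm_deriv_le
    (fun x _ => hf.differentiable_fst y t x) hM h₁ h₂

lemma abs_sub_le_of_pdy (hf : Smooth f) {x y₁ y₂ t L M : ℝ}
    (hM : ∀ y ∈ Set.Icc 0 L, |RMAC.pdy f x y t| ≤ M)
    (h₁ : y₁ ∈ Set.Icc 0 L) (h₂ : y₂ ∈ Set.Icc 0 L) :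
    |f x y₂ t - f x y₁ t| ≤ M * |y₂ - y₁| :=
  (convex_Icc (0 : ℝ) L).norm_image_sub_le_of_norm_deriv_le
    (fun y _ => hf.differentiable_snd x t y) hM h₁ h₂

end Smooth

/-! ### Sums over integer intervals -/

lemma sum_Icc_int_succ {a b : ℤ} (hab : a ≤ b + 1) (f : ℤ → ℝ) :
    ∑ i ∈ Finset.Icc a (b + 1), f i = ∑ i ∈ Finset.Icc a b, f i + f (b + 1) := by
  have h : Finset.Icc a (b + 1) = insert (b + 1) (Finset.Icc a b) := by
    ext i
    simp only [Finset.mem_Icc, Finset.mem_insert]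
    omega
  rw [h, Finset.sum_insert (by simp), add_comm]

lemma sum_Icc_int_sub (f : ℤ → ℝ) {a b : ℤ} (hab : a - 1 ≤ b) :
    ∑ i ∈ Finset.Icc a b, (f (i + 1) - f i) = f (b + 1) - f a := by
  induction b, hab using Int.leInduction with
  | base => simp
  | succ b hb ih =>
    rw [sum_Icc_int_succ (by omega), ih]
    ring

/-- Summation by parts on a one-dimensional staggered grid. -/
lemma sum_Icc_int_by_parts (q v : ℤ → ℝ) {b : ℤ} (hb : 0 ≤ b) :
    ∑ i ∈ Finset.Icc 1 b, (q i - q (i - 1)) * v i =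
      q b * v (b + 1) - q 0 * v 0 - ∑ i ∈ Finset.Icc 0 b, q i * (v (i + 1) - v i) := by
  induction b, hb using Int.leInduction with
  | base =>
    simp
    ring
  | succ b hb ih =>
    rw [sum_Icc_int_succ (by omega), sum_Icc_int_succ (by omega), ih, add_sub_cancel_right]
    ring

namespace Grid

variable (G : Grid)

/-- The grid with the roles of `x` and `y` exchanged. -/
def swap : Grid where
  Nx := G.Ny
  Ny := G.Nx
  Lx := G.Ly
  Ly := G.Lx
  xp := G.yp
  yp := G.xp
  one_le_Nx := G.one_le_Ny
  one_le_Ny := G.one_le_Nx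
  xp_zero := G.yp_zero
  xp_last := G.yp_last
  yp_zero := G.xp_zero
  yp_last := G.xp_last
  xp_mono := G.yp_mono
  yp_mono := G.xp_mono

lemma ipTM_swap (f g : ℤ → ℤ → ℝ) :
    G.swap.ipTM (fun i j => f j i) (fun i j => g j i) = G.ipMT f g := by
  simp only [ipTM, ipMT]
  rw [Finset.sum_comm]
  refine Finset.sum_congr rfl fun i _ => Finset.sum_congr rfl fun j _ => ?_
  change G.kc j * G.hh i * f i j * g i j = _
  ring

/-! ### Elementary facts about the mesh -/

lemma xp_le {i j : ℤ} (hi : 0 ≤ i) (hij : i ≤ j) (hj : j ≤ G.Nx) : G.xp i ≤ G.xp j := by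
  induction j, hij using Int.leInduction with
  | base => exact le_rfl
  | succ j hij ih => exact (ih (by omega)).trans (G.xp_mono j (by omega) (by omega)).le

lemma xp_mem {i : ℤ} (hi : 0 ≤ i) (hi' : i ≤ G.Nx) : G.xp i ∈ Set.Icc 0 G.Lx := by
  have h₁ := G.xp_le le_rfl hi hi'
  have h₂ := G.xp_le hi hi' le_rfl
  rw [G.xp_zero] at h₁
  rw [G.xp_last] at h₂
  exact ⟨h₁, h₂⟩

lemma xh_mem {i : ℤ} (hi : 0 ≤ i) (hi' : i < G.Nx) : G.xh i ∈ Set.Icc 0 G.Lx := by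
  have h₁ := G.xp_mem hi hi'.le
  have h₂ := G.xp_mem (i := i + 1) (by omega) (by omega)
  constructor <;> simp only [xh] <;> linarith [h₁.1, h₁.2, h₂.1, h₂.2]

lemma yh_mem {j : ℤ} (hj : 0 ≤ j) (hj' : j < G.Ny) : G.yh j ∈ Set.Icc 0 G.Ly :=
  G.swap.xh_mem hj hj'

lemma hh_pos {i : ℤ} (hi : 0 ≤ i) (hi' : i < G.Nx) : 0 < G.hh i :=
  sub_pos.mpr (G.xp_mono i hi hi')

lemma kk_pos {j : ℤ} (hj : 0 ≤ j) (hj' : j < G.Ny) : 0 < G.kk j :=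
  G.swap.hh_pos hj hj'

lemma hh_le_hmax {i : ℤ} (hi : 0 ≤ i) (hi' : i < G.Nx) : G.hh i ≤ G.hmax :=
  Finset.le_sup' G.hh (Finset.mem_Icc.mpr ⟨hi, by omega⟩)

lemma kk_le_kmax {j : ℤ} (hj : 0 ≤ j) (hj' : j < G.Ny) : G.kk j ≤ G.kmax :=
  G.swap.hh_le_hmax hj hj'

lemma hc_eq {i : ℤ} (hi : 0 < i) (hi' : i < G.Nx) : G.hc i = G.xh i - G.xh (i - 1) := by
  simp only [hc, if_neg hi.ne', if_neg hi'.ne, hh, xh, sub_add_cancel]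
  ring

lemma kc_eq {j : ℤ} (hj : 0 < j) (hj' : j < G.Ny) : G.kc j = G.yh j - G.yh (j - 1) :=
  G.swap.hc_eq hj hj'

lemma hc_pos {i : ℤ} (hi : 0 < i) (hi' : i < G.Nx) : 0 < G.hc i := by
  have h₁ := G.hh_pos (i := i - 1) (by omega) (by omega)
  have h₂ := G.hh_pos hi.le hi'
  simp only [hc, if_neg hi.ne', if_neg hi'.ne]
  positivity

lemma kc_pos {j : ℤ} (hj : 0 < j) (hj' : j < G.Ny) : 0 < G.kc j :=
  G.swap.hc_pos hj hj'

lemma sum_hh : ∑ i ∈ Finset.Icc (0 : ℤ) ((G.Nx : ℤ) - 1), G.hh i = G.Lx := by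
  simp only [hh]
  rw [sum_Icc_int_sub G.xp (by omega), sub_add_cancel, G.xp_last, G.xp_zero, sub_zero]

lemma sum_kk : ∑ j ∈ Finset.Icc (0 : ℤ) ((G.Ny : ℤ) - 1), G.kk j = G.Ly :=
  G.swap.sum_hh

lemma sum_kc_le : ∑ j ∈ Finset.Icc (1 : ℤ) ((G.Ny : ℤ) - 1), G.kc j ≤ G.Ly := by
  have hN := G.one_le_Ny
  have h : ∑ j ∈ Finset.Icc (1 : ℤ) ((G.Ny : ℤ) - 1), G.kc j =
      ∑ j ∈ Finset.Icc (1 : ℤ) ((G.Ny : ℤ) - 1), (G.yh (j + 1 - 1) - G.yh (j - 1)) :=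
    Finset.sum_congr rfl fun j hj => by
      rw [Finset.mem_Icc] at hj
      rw [G.kc_eq (by omega) (by omega), add_sub_cancel_right]
  rw [h, sum_Icc_int_sub (fun j => G.yh (j - 1)) (by omega)]
  have h₁ := (G.yh_mem (j := (G.Ny : ℤ) - 1 + 1 - 1) (by omega) (by omega)).2
  have h₂ := (G.yh_mem (j := 1 - 1) (by omega) (by omega)).1
  linarith

/-! ### The cross terms -/

lemma ipTM_DxC (q vx : ℤ → ℤ → ℝ) (hvx : ∀ j : ℤ, vx 0 j = 0 ∧ vx (G.Nx : ℤ) j = 0) :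
    G.ipTM (G.DxC q) vx = -G.ipM q (G.dxEx vx) := by
  have hN := G.one_le_Nx
  simp only [ipTM, ipM]
  rw [Finset.sum_comm, Finset.sum_comm (s := Finset.Icc (0 : ℤ) ((G.Nx : ℤ) - 1)),
    ← Finset.sum_neg_distrib]
  refine Finset.sum_congr rfl fun j _ => ?_
  have h := sum_Icc_int_by_parts (fun i => q i j) (fun i => vx i j)
    (b := (G.Nx : ℤ) - 1) (by omega)
  simp only [sub_add_cancel, (hvx j).1, (hvx j).2, mul_zero, sub_zero, zero_sub] at h
  calc _ = G.kk j * ∑ i ∈ Finset.Icc 1 ((G.Nx : ℤ) - 1), (q i j - q (i - 1) j) * vx i j := by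
        rw [Finset.mul_sum]
        refine Finset.sum_congr rfl fun i hi => ?_
        rw [Finset.mem_Icc] at hi
        have := (G.hc_pos (i := i) (by omega) (by omega)).ne'
        simp only [DxC]
        field_simp
    _ = _ := by
        rw [h, mul_neg, Finset.mul_sum]
        congr 1
        refine Finset.sum_congr rfl fun i hi => ?_
        rw [Finset.mem_Icc] at hi
        have := (G.hh_pos (i := i) (by omega) (by omega)).ne'
        simp only [dxEx]
        field_simp

lemma ipMT_DyC (q vy : ℤ → ℤ → ℝ) (hvy : ∀ i : ℤ, vy i 0 = 0 ∧ vy i (G.Ny : ℤ) = 0) :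
    G.ipMT (G.DyC q) vy = -G.ipM q (G.dyEy vy) := by
  rw [← ipTM_swap]
  refine (G.swap.ipTM_DxC (fun i j => q j i) (fun i j => vy j i) hvy).trans ?_
  simp only [ipM]
  rw [Finset.sum_comm]
  congr 1
  refine Finset.sum_congr rfl fun i _ => Finset.sum_congr rfl fun j _ => ?_
  change G.kk j * G.hh i * q i j * G.dyEy vy i j = _
  ring

/-- A cell-centred function `q` bounded by `A` with `|D_y q| ≤ B` pairs with `v^x` through
`D_x q` only via the discrete divergence of `v` and via `(D_y q, v^y)`. -/
lemma ipTM_DxC_le {ε A B D : ℝ} (hε : 0 < ε) (hA : 0 ≤ A) (q vx vy : ℤ → ℤ → ℝ)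
    (hvx : ∀ j : ℤ, vx 0 j = 0 ∧ vx (G.Nx : ℤ) j = 0)
    (hvy : ∀ i : ℤ, vy i 0 = 0 ∧ vy i (G.Ny : ℤ) = 0)
    (hq : ∀ i j : ℤ, 0 ≤ i → i < G.Nx → 0 ≤ j → j < G.Ny → |q i j| ≤ A)
    (hqy : ∀ i j : ℤ, 0 ≤ i → i < G.Nx → 0 < j → j < G.Ny →
      |q i j - q i (j - 1)| ≤ B * G.kc j)
    (hdiv : ∀ i ∈ Finset.Icc (0 : ℤ) ((G.Nx : ℤ) - 1),
      ∀ j ∈ Finset.Icc (0 : ℤ) ((G.Ny : ℤ) - 1), |G.dxEx vx i j + G.dyEy vy i j| ≤ D) :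
    G.ipTM (G.DxC q) vx ≤
      ε * G.ipMT vy vy + G.Lx * G.Ly * (A * D + B ^ 2 / (4 * ε)) := by
  have hsplit : G.ipTM (G.DxC q) vx =
      G.ipM q (fun i j => -(G.dxEx vx i j + G.dyEy vy i j)) - G.ipMT (G.DyC q) vy := by
    rw [G.ipTM_DxC q vx hvx, G.ipMT_DyC q vy hvy]
    simp only [ipM, ← Finset.sum_neg_distrib, ← Finset.sum_sub_distrib]
    refine Finset.sum_congr rfl fun i _ => Finset.sum_congr rfl fun j _ => ?_
    ring
  have hM : G.ipM q (fun i j => -(G.dxEx vx i j + G.dyEy vy i j)) ≤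
      G.Lx * G.Ly * (A * D) := by
    rw [← G.sum_hh, ← G.sum_kk, Finset.sum_mul_sum, Finset.sum_mul]
    refine Finset.sum_le_sum fun i hi => ?_
    rw [Finset.sum_mul]
    refine Finset.sum_le_sum fun j hj => ?_
    have hd := hdiv i hi j hj
    rw [Finset.mem_Icc] at hi hj
    have hpos := mul_pos (G.hh_pos (i := i) (by omega) (by omega))
      (G.kk_pos (j := j) (by omega) (by omega))
    rw [mul_assoc]
    refine mul_le_mul_of_nonneg_left ?_ hpos.le
    refine (le_abs_self _).trans ?_
    rw [abs_mul, abs_neg]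
    exact mul_le_mul (hq i j (by omega) (by omega) (by omega) (by omega)) hd (abs_nonneg _) hA
  have hMT : -G.ipMT (G.DyC q) vy ≤ ε * G.ipMT vy vy + G.Lx * G.Ly * (B ^ 2 / (4 * ε)) := by
    have hLx : 0 ≤ G.Lx := by
      rw [← G.sum_hh]
      refine Finset.sum_nonneg fun i hi => ?_
      rw [Finset.mem_Icc] at hi
      exact (G.hh_pos (by omega) (by omega)).le
    have hterm : -G.ipMT (G.DyC q) vy ≤ ε * G.ipMT vy vy +
        G.Lx * (∑ j ∈ Finset.Icc (1 : ℤ) ((G.Ny : ℤ) - 1), G.kc j) * (B ^ 2 / (4 * ε)) := by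
      rw [← G.sum_hh, Finset.sum_mul_sum]
      simp only [ipMT, Finset.mul_sum, Finset.sum_mul, ← Finset.sum_neg_distrib,
        ← Finset.sum_add_distrib]
      refine Finset.sum_le_sum fun i hi => Finset.sum_le_sum fun j hj => ?_
      rw [Finset.mem_Icc] at hi hj
      have hkc := G.kc_pos (j := j) (by omega) (by omega)
      have hpos := mul_pos (G.hh_pos (i := i) (by omega) (by omega)) hkc
      have hD : |G.DyC q i j| ≤ B := by
        rw [DyC, abs_div, abs_of_pos hkc, div_le_iff₀ hkc]
        exact hqy i j (by omega) (by omega) (by omega) (by omega)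
      have hB : (G.DyC q i j) ^ 2 ≤ B ^ 2 := sq_le_sq' (abs_le.mp hD).1 (abs_le.mp hD).2
      have hyoung : -(G.DyC q i j * vy i j) ≤ ε * vy i j ^ 2 + B ^ 2 / (4 * ε) := by
        have h₁ : (G.DyC q i j) ^ 2 / (4 * ε) ≤ B ^ 2 / (4 * ε) := by gcongr
        have h₂ : ε * vy i j ^ 2 + (G.DyC q i j) ^ 2 / (4 * ε) + G.DyC q i j * vy i j =
            ε * (vy i j + G.DyC q i j / (2 * ε)) ^ 2 := by
          field_simp
          ring
        have h₃ : 0 ≤ ε * (vy i j + G.DyC q i j / (2 * ε)) ^ 2 := by positivity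
        linarith
      have := mul_le_mul_of_nonneg_left hyoung hpos.le
      linarith
    refine hterm.trans ?_
    gcongr
    exact G.sum_kc_le
  rw [hsplit]
  linarith

lemma ipMT_DyC_le {ε A B D : ℝ} (hε : 0 < ε) (hA : 0 ≤ A) (q vx vy : ℤ → ℤ → ℝ)
    (hvx : ∀ j : ℤ, vx 0 j = 0 ∧ vx (G.Nx : ℤ) j = 0)
    (hvy : ∀ i : ℤ, vy i 0 = 0 ∧ vy i (G.Ny : ℤ) = 0)
    (hq : ∀ i j : ℤ, 0 ≤ i → i < G.Nx → 0 ≤ j → j < G.Ny → |q i j| ≤ A)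
    (hqx : ∀ i j : ℤ, 0 < i → i < G.Nx → 0 ≤ j → j < G.Ny →
      |q i j - q (i - 1) j| ≤ B * G.hc i)
    (hdiv : ∀ i ∈ Finset.Icc (0 : ℤ) ((G.Nx : ℤ) - 1),
      ∀ j ∈ Finset.Icc (0 : ℤ) ((G.Ny : ℤ) - 1), |G.dxEx vx i j + G.dyEy vy i j| ≤ D) :
    G.ipMT (G.DyC q) vy ≤
      ε * G.ipTM vx vx + G.Lx * G.Ly * (A * D + B ^ 2 / (4 * ε)) := by
  have h := G.swap.ipTM_DxC_le hε hA (fun i j => q j i) (fun i j => vy j i)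
    (fun i j => vx j i) (B := B) (D := D) hvy hvx
    (fun i j hi hi' hj hj' => hq j i hj hj' hi hi')
    (fun i j hi hi' hj hj' => hqx j i hj hj' hi hi')
    (fun i hi j hj => by rw [add_comm]; exact hdiv j hj i hi)
  have h₁ := G.ipTM_swap (G.DyC q) vy
  have h₂ := G.swap.ipTM_swap (fun i j => vx j i) (fun i j => vx j i)
  rw [← h₁, mul_comm G.Lx, show G.ipTM vx vx = _ from h₂]
  exact h

/-! ### Bounds on the consistency functions -/

section Gamma

variable {ux uy : ℝ → ℝ → ℝ → ℝ} {T M Δt : ℝ} {n : ℕ} {i j : ℤ}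

lemma abs_gammax_le (hS : SobBound 1 3 ux G.Lx G.Ly T M) (ht : (n : ℝ) * Δt ∈ Set.Icc 0 T)
    (hi : 0 ≤ i) (hi' : i < G.Nx) (hj : 0 ≤ j) (hj' : j < G.Ny) :
    |G.gammax ux Δt n i j| ≤ G.hmax ^ 2 / 8 * M := by
  have h := hS 1 1 0 le_rfl (by norm_num) _ _ _ (G.xh_mem hi hi') (G.yh_mem hj hj') ht
  have h₀ := (G.hh_pos hi hi').le
  have h₁ := G.hh_le_hmax hi hi'
  rw [gammax, abs_mul, abs_of_nonneg (by positivity : 0 ≤ G.hh i ^ 2 / 8)]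
  exact mul_le_mul (by gcongr) h (abs_nonneg _) (by positivity)

lemma abs_gammay_le (hS : SobBound 1 3 uy G.Lx G.Ly T M) (ht : (n : ℝ) * Δt ∈ Set.Icc 0 T)
    (hi : 0 ≤ i) (hi' : i < G.Nx) (hj : 0 ≤ j) (hj' : j < G.Ny) :
    |G.gammay uy Δt n i j| ≤ G.kmax ^ 2 / 8 * M := by
  have h := hS 1 0 1 le_rfl (by norm_num) _ _ _ (G.xh_mem hi hi') (G.yh_mem hj hj') ht
  have h₀ := (G.kk_pos hj hj').le
  have h₁ := G.kk_le_kmax hj hj'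
  rw [gammay, abs_mul, abs_of_nonneg (by positivity : 0 ≤ G.kk j ^ 2 / 8)]
  exact mul_le_mul (by gcongr) h (abs_nonneg _) (by positivity)

lemma abs_gammax_sub_le (hu : Smooth ux) (hS : SobBound 1 3 ux G.Lx G.Ly T M)
    (ht : (n : ℝ) * Δt ∈ Set.Icc 0 T)
    (hi : 0 ≤ i) (hi' : i < G.Nx) (hj : 0 < j) (hj' : j < G.Ny) :
    |G.gammax ux Δt n i j - G.gammax ux Δt n i (j - 1)| ≤ G.hmax ^ 2 / 8 * M * G.kc j := by
  have hcomm : pdy (pdt (pdx ux)) = pdt (pdx (pdy ux)) := by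
    rw [hu.pdx.pdy_pdt, hu.pdx_pdy]
  have h := hu.pdx.pdt.abs_sub_le_of_pdy (x := G.xh i) (t := (n : ℝ) * Δt) (M := M)
    (fun y hy => by
      rw [hcomm]
      exact hS 1 1 1 le_rfl (by norm_num) _ _ _ (G.xh_mem hi hi') hy ht)
    (G.yh_mem (j := j - 1) (by omega) (by omega)) (G.yh_mem hj.le hj')
  rw [← G.kc_eq hj hj', abs_of_pos (G.kc_pos hj hj')] at h
  have h₀ := (G.hh_pos hi hi').le
  have h₁ := G.hh_le_hmax hi hi'
  rw [gammax, gammax, ← mul_sub, abs_mul, abs_of_nonneg (by positivity : 0 ≤ G.hh i ^ 2 / 8),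
    mul_assoc]
  exact mul_le_mul (by gcongr) h (abs_nonneg _) (by positivity)

lemma abs_gammay_sub_le (hu : Smooth uy) (hS : SobBound 1 3 uy G.Lx G.Ly T M)
    (ht : (n : ℝ) * Δt ∈ Set.Icc 0 T)
    (hi : 0 < i) (hi' : i < G.Nx) (hj : 0 ≤ j) (hj' : j < G.Ny) :
    |G.gammay uy Δt n i j - G.gammay uy Δt n (i - 1) j| ≤ G.kmax ^ 2 / 8 * M * G.hc i := by
  have h := hu.pdy.pdt.abs_sub_le_of_pdx (y := G.yh j) (t := (n : ℝ) * Δt) (M := M)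
    (fun x hx => by
      rw [hu.pdy.pdx_pdt]
      exact hS 1 1 1 le_rfl (by norm_num) _ _ _ hx (G.yh_mem hj hj') ht)
    (G.xh_mem (i := i - 1) (by omega) (by omega)) (G.xh_mem hi.le hi')
  rw [← G.hc_eq hi hi', abs_of_pos (G.hc_pos hi hi')] at h
  have h₀ := (G.kk_pos hj hj').le
  have h₁ := G.kk_le_kmax hj hj'
  rw [gammay, gammay, ← mul_sub, abs_mul, abs_of_nonneg (by positivity : 0 ≤ G.kk j ^ 2 / 8),
    mul_assoc]
  exact mul_le_mul (by gcongr) h (abs_nonneg _) (by positivity)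

end Gamma

end Grid

end RMAC

/-- cross-term estimate for the time-consistency terms `γ`.
If `v` is a discrete velocity with zero boundary values whose discrete divergence is
pointwise `O(h²+k²+Δt)`, then for every `ε > 0` there is a constant `C` depending only on
`ε`, `K`, `Ω` and `‖u‖_{W^{1,∞}W^{3,∞}}` with
`(D_x γ^{x,n}, v^x)_{l²,T,M} + (D_y γ^{y,n}, v^y)_{l²,M,T} ≤ ε‖v‖²_{l²} + C(h²+k²+Δt)²`. -/
theorem gamma_cross_term_estimate (Lx Ly Mu K ε : ℝ)
    (hLx : 0 < Lx) (hLy : 0 < Ly) (hMu : 0 ≤ Mu) (hK : 0 ≤ K) (hε : 0 < ε) :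
    ∃ C : ℝ, 0 < C ∧
      ∀ T : ℝ, 0 < T → ∀ N : ℕ, 1 ≤ N → ∀ Δt : ℝ, Δt = T / N →
      ∀ G : RMAC.Grid, G.Lx = Lx → G.Ly = Ly →
      ∀ ux uy : ℝ → ℝ → ℝ → ℝ, RMAC.Smooth ux → RMAC.Smooth uy →
        RMAC.SobBound 1 3 ux Lx Ly T Mu → RMAC.SobBound 1 3 uy Lx Ly T Mu →
      ∀ vx vy : ℤ → ℤ → ℝ,
        (∀ j : ℤ, vx 0 j = 0 ∧ vx (G.Nx : ℤ) j = 0) →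
        (∀ i : ℤ, vx i (-1) = 0 ∧ vx i (G.Ny : ℤ) = 0) →
        (∀ i : ℤ, vy i 0 = 0 ∧ vy i (G.Ny : ℤ) = 0) →
        (∀ j : ℤ, vy (-1) j = 0 ∧ vy (G.Nx : ℤ) j = 0) →
        (∀ i ∈ Finset.Icc (0 : ℤ) ((G.Nx : ℤ) - 1),
          ∀ j ∈ Finset.Icc (0 : ℤ) ((G.Ny : ℤ) - 1),
            |G.dxEx vx i j + G.dyEy vy i j| ≤ K * (G.hmax ^ 2 + G.kmax ^ 2 + Δt)) →
      ∀ n : ℕ, n ≤ N →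
        G.ipTM (G.DxC (G.gammax ux Δt n)) vx + G.ipMT (G.DyC (G.gammay uy Δt n)) vy ≤
          ε * G.velNormSq vx vy + C * (G.hmax ^ 2 + G.kmax ^ 2 + Δt) ^ 2 := by
  refine ⟨Lx * Ly * (Mu * K + Mu ^ 2 / ε) + 1, by positivity, ?_⟩
  rintro T hT N hN Δt rfl G rfl rfl ux uy hux huy hSx hSy vx vy hvx - hvy - hdiv n hn
  have hN₀ : (0 : ℝ) < N := by exact_mod_cast hN
  have ht : (n : ℝ) * (T / N) ∈ Set.Icc 0 T := by
    refine ⟨by positivity, ?_⟩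
    rw [← mul_div_assoc, div_le_iff₀ hN₀, mul_comm]
    have : (n : ℝ) ≤ N := by exact_mod_cast hn
    gcongr
  have hΔt : 0 < T / N := by positivity
  set S := G.hmax ^ 2 + G.kmax ^ 2 + T / N with hS
  have hh₀ := sq_nonneg G.hmax
  have hk₀ := sq_nonneg G.kmax
  have hS₀ : 0 ≤ S := by linarith
  have hA : ∀ a : ℝ, 0 ≤ a → a ≤ S →
      a / 8 * Mu * (K * S) + (a / 8 * Mu) ^ 2 / (4 * ε) ≤
        (Mu * K + Mu ^ 2 / ε) / 2 * S ^ 2 := by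
    intro a ha haS
    have h₁ : a / 8 * Mu * (K * S) ≤ S / 8 * Mu * (K * S) := by gcongr
    have h₂ : (a / 8 * Mu) ^ 2 / (4 * ε) ≤ (S / 8 * Mu) ^ 2 / (4 * ε) := by gcongr
    have h₃ : (S / 8 * Mu) ^ 2 / (4 * ε) = Mu ^ 2 / ε * S ^ 2 / 256 := by
      field_simp
      ring
    have h₄ : 0 ≤ Mu ^ 2 / ε * S ^ 2 := by positivity
    have h₅ : 0 ≤ Mu * K * S ^ 2 := by positivity
    nlinarith
  have hx := G.ipTM_DxC_le hε (by positivity) (G.gammax ux (T / N) n) vx vy hvx hvy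
    (fun i j hi hi' hj hj' => G.abs_gammax_le hSx ht hi hi' hj hj')
    (fun i j hi hi' hj hj' => G.abs_gammax_sub_le hux hSx ht hi hi' hj hj') hdiv
  have hy := G.ipMT_DyC_le hε (by positivity) (G.gammay uy (T / N) n) vx vy hvx hvy
    (fun i j hi hi' hj hj' => G.abs_gammay_le hSy ht hi hi' hj hj')
    (fun i j hi hi' hj hj' => G.abs_gammay_sub_le huy hSy ht hi hi' hj hj') hdiv
  have hLL : 0 ≤ G.Lx * G.Ly := by positivity
  have hAx := mul_le_mul_of_nonneg_left (hA (G.hmax ^ 2) hh₀ (by linarith)) hLL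
  have hAy := mul_le_mul_of_nonneg_left (hA (G.kmax ^ 2) hk₀ (by linarith)) hLL
  simp only [Grid.velNormSq]
  have := sq_nonneg S
  linarith
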